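/- arXiv:2101.04967 — 2 statements merged into one kernel-verified Lean document; each statement's English description precedes it below -/
import Mathlib

section
/- A topological dynamical system (X,T) is continuously strictly pointwise ergodic if and only if it is strictly partitionable, the set ℳ_T^e(X) of ergodic measures is compact in the weak-star topology, and the set-valued function supp : ℳ_T^e(X) → 2^X is continuous. Moreover, in this case the generic-point partition 𝒫 is continuous (both upper and lower semicontinuous). -/
open MeasureTheory Filter Topology Metric

section TopDefs

variable {X : Type*} [MetricSpace X]

/-- The Cesàro (Birkhoff) averages `(1/n) ∑_{i<n} f(Tⁱ x)`. -/
noncomputable def cesaro (T : X → X) (f : X → ℝ) (n : ℕ) (x : X) : ℝ :=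
  (n : ℝ)⁻¹ * ∑ i ∈ Finset.range n, f (T^[i] x)

/-- `P` is a partition of `X` (into nonempty sets, every point in exactly one atom). -/
def IsPartition (P : Set (Set X)) : Prop :=
  (∀ A ∈ P, A.Nonempty) ∧ ∀ x : X, ∃! A : Set X, A ∈ P ∧ x ∈ A

/-- A partition is upper semicontinuous if whenever a sequence of atoms converges in the
Hausdorff metric to a (nonempty compact) set `S`, then `S` is contained in some atom. -/
def PartitionUSC (P : Set (Set X)) : Prop :=
  ∀ A : ℕ → Set X, (∀ n, A n ∈ P) → ∀ S : Set X, S.Nonempty → IsCompact S →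
    Tendsto (fun n => hausdorffDist (A n) S) atTop (𝓝 0) → ∃ B ∈ P, S ⊆ B

/-- A partition is lower semicontinuous if whenever a sequence of atoms converges in the
Hausdorff metric to a (nonempty compact) set `S`, then `S` contains some atom. -/
def PartitionLSC (P : Set (Set X)) : Prop :=
  ∀ A : ℕ → Set X, (∀ n, A n ∈ P) → ∀ S : Set X, S.Nonempty → IsCompact S →
    Tendsto (fun n => hausdorffDist (A n) S) atTop (𝓝 0) → ∃ B ∈ P, B ⊆ S

/-- Upper semicontinuity of a (compact-)set-valued function: if `yₙ → y₀` and
`f(yₙ) → S` in the Hausdorff metric, then `S ⊆ f(y₀)`. -/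
def SetValuedUSC {Y : Type*} [MetricSpace Y] (f : Y → Set X) : Prop :=
  ∀ (y : ℕ → Y) (y₀ : Y), Tendsto y atTop (𝓝 y₀) →
    ∀ S : Set X, S.Nonempty → IsCompact S →
      Tendsto (fun n => hausdorffDist (f (y n)) S) atTop (𝓝 0) → S ⊆ f y₀

/-- Lower semicontinuity of a (compact-)set-valued function: if `yₙ → y₀` and
`f(yₙ) → S` in the Hausdorff metric, then `f(y₀) ⊆ S`. -/
def SetValuedLSC {Y : Type*} [MetricSpace Y] (f : Y → Set X) : Prop :=
  ∀ (y : ℕ → Y) (y₀ : Y), Tendsto y atTop (𝓝 y₀) →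
    ∀ S : Set X, S.Nonempty → IsCompact S →
      Tendsto (fun n => hausdorffDist (f (y n)) S) atTop (𝓝 0) → f y₀ ⊆ S

/-- A set is invariant for the homeomorphism `T` if `T(K) = K`. -/
def IsInvariantSet (T : X ≃ₜ X) (K : Set X) : Prop := T '' K = K

/-- A minimal set: nonempty, closed, invariant, with no proper nonempty closed invariant
subset. -/
def IsMinimalSet (T : X ≃ₜ X) (K : Set X) : Prop :=
  K.Nonempty ∧ IsClosed K ∧ IsInvariantSet T K ∧
    ∀ K' : Set X, K' ⊆ K → K'.Nonempty → IsClosed K' → IsInvariantSet T K' → K' = K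

/-- A system is semi-simple if `X` is a union of minimal sets. -/
def SemiSimple (T : X ≃ₜ X) : Prop :=
  ∀ x : X, ∃ K : Set X, IsMinimalSet T K ∧ x ∈ K

/-- A system is uniform if the Cesàro means of every continuous function converge
uniformly on `X`. -/
def UniformSystem (T : X ≃ₜ X) : Prop :=
  ∀ f : C(X, ℝ), ∃ g : X → ℝ,
    TendstoUniformly (fun n x => cesaro (⇑T) (⇑f) n x) g atTop

/-- Uniformity of the subsystem carried by the set `M`: the Cesàro means of every
continuous function converge uniformly on `M`. -/
def UniformOn (T : X ≃ₜ X) (M : Set X) : Prop :=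
  ∀ f : C(X, ℝ), ∃ g : X → ℝ,
    TendstoUniformlyOn (fun n x => cesaro (⇑T) (⇑f) n x) g atTop M

/-- Strictly uniform = uniform + semi-simple. -/
def StrictlyUniform (T : X ≃ₜ X) : Prop := UniformSystem T ∧ SemiSimple T

end TopDefs

section MeasDefs

variable {X : Type*} [MetricSpace X] [CompactSpace X]
  [MeasurableSpace X] [BorelSpace X]

/-- A `T`-invariant Borel probability measure. -/
def IsInvariantMeasure (T : X ≃ₜ X) (μ : ProbabilityMeasure X) : Prop :=
  μ.toMeasure.map ⇑T = μ.toMeasure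

/-- An ergodic `T`-invariant Borel probability measure. -/
def IsErgodicMeasure (T : X ≃ₜ X) (μ : ProbabilityMeasure X) : Prop :=
  Ergodic (⇑T) μ.toMeasure

/-- `x` is generic for `μ`: the Cesàro means of every continuous function at `x`
converge to the integral of the function against `μ`. -/
def IsGenericFor (T : X ≃ₜ X) (x : X) (μ : ProbabilityMeasure X) : Prop :=
  ∀ f : C(X, ℝ),
    Tendsto (fun n => cesaro (⇑T) (⇑f) n x) atTop (𝓝 (∫ y, f y ∂μ.toMeasure))

/-- Pointwise ergodic: every point is generic for some ergodic measure. -/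
def PointwiseErgodic (T : X ≃ₜ X) : Prop :=
  ∀ x : X, ∃ μ : ProbabilityMeasure X, IsErgodicMeasure T μ ∧ IsGenericFor T x μ

/-- The set of points generic for `μ` (a fiber of the map `Φ`). -/
def genericFiber (T : X ≃ₜ X) (μ : ProbabilityMeasure X) : Set X :=
  {x : X | IsGenericFor T x μ}

/-- The generic-point partition `𝒫`: the (nonempty) fibers of the map `Φ` sending each
point to the ergodic measure it generates. -/
def genericPartition (T : X ≃ₜ X) : Set (Set X) :=
  {A : Set X | ∃ μ : ProbabilityMeasure X, IsErgodicMeasure T μ ∧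
    (genericFiber T μ).Nonempty ∧ A = genericFiber T μ}

/-- Continuously pointwise ergodic: every point is generic for an ergodic measure and the
map `Φ` sending each point to that measure is continuous (weak-star topology). -/
def ContinuouslyPointwiseErgodic (T : X ≃ₜ X) : Prop :=
  ∃ Φ : X → ProbabilityMeasure X, Continuous Φ ∧
    ∀ x : X, IsErgodicMeasure T (Φ x) ∧ IsGenericFor T x (Φ x)

/-- Continuously strictly pointwise ergodic = continuously pointwise ergodic +
semi-simple. -/
def ContinuouslyStrictlyPointwiseErgodic (T : X ≃ₜ X) : Prop :=
  ContinuouslyPointwiseErgodic T ∧ SemiSimple T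

/-- The set `K` carries exactly one `T`-invariant Borel probability measure. -/
def UniquelyErgodicOn (T : X ≃ₜ X) (K : Set X) : Prop :=
  ∃! μ : ProbabilityMeasure X, IsInvariantMeasure T μ ∧ μ.toMeasure K = 1

/-- Partitionable: `X` is a disjoint union of closed invariant uniquely ergodic sets. -/
def Partitionable (T : X ≃ₜ X) : Prop :=
  ∃ P : Set (Set X), IsPartition P ∧
    ∀ K ∈ P, IsClosed K ∧ IsInvariantSet T K ∧ UniquelyErgodicOn T K

/-- Strictly partitionable: `X` is a union of strictly ergodic (minimal and uniquely
ergodic) subsystems. -/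
def StrictlyPartitionable (T : X ≃ₜ X) : Prop :=
  ∀ x : X, ∃ K : Set X, x ∈ K ∧ IsMinimalSet T K ∧ UniquelyErgodicOn T K

/-- The topological support of a measure: points all of whose open neighborhoods have
positive measure (equivalently, the smallest closed set of full measure). -/
def msupp (μ : ProbabilityMeasure X) : Set X :=
  {x : X | ∀ U : Set X, IsOpen U → x ∈ U → 0 < μ.toMeasure U}

/-- The set `ℳ_T^e(X)` of ergodic invariant probability measures. -/
def ErgodicSet (T : X ≃ₜ X) : Set (ProbabilityMeasure X) :=
  {μ : ProbabilityMeasure X | IsErgodicMeasure T μ}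

/-- Continuity of the set-valued map `supp : ℳ_T^e(X) → 2^X` (sequentially, via the
Hausdorff metric; `ℳ_T^e(X)` carries the weak-star topology, which is metrizable). -/
def SuppContinuousOnErgodic (T : X ≃ₜ X) : Prop :=
  ∀ μ ∈ ErgodicSet T, ∀ ν : ℕ → ProbabilityMeasure X,
    (∀ n, ν n ∈ ErgodicSet T) → Tendsto ν atTop (𝓝 μ) →
    Tendsto (fun n => hausdorffDist (msupp (ν n)) (msupp μ)) atTop (𝓝 0)

end MeasDefs

section Helpers

set_option linter.unusedSectionVars false

variable {X : Type*} [MetricSpace X] [CompactSpace X] [MeasurableSpace X] [BorelSpace X]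

lemma h_integrable (μ : Measure X) [IsFiniteMeasure μ] (f : C(X, ℝ)) : Integrable f μ :=
  (BoundedContinuousFunction.mkOfCompact f).integrable μ

lemma h_mext (μ ν : Measure X) [IsFiniteMeasure μ] [IsFiniteMeasure ν]
    (h : ∀ f : C(X, ℝ), ∫ y, f y ∂μ = ∫ y, f y ∂ν) : μ = ν :=
  ext_of_forall_integral_eq_of_IsFiniteMeasure fun f => h f.toContinuousMap

lemma h_ext (μ ν : ProbabilityMeasure X)
    (h : ∀ f : C(X, ℝ), ∫ y, f y ∂μ.toMeasure = ∫ y, f y ∂ν.toMeasure) : μ = ν :=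
  Subtype.ext (h_mext μ.toMeasure ν.toMeasure h)

lemma h_tendsto {ι : Type*} {l : Filter ι} {ν : ι → ProbabilityMeasure X}
    {μ : ProbabilityMeasure X} : Tendsto ν l (𝓝 μ) ↔
    ∀ f : C(X, ℝ), Tendsto (fun i => ∫ y, f y ∂(ν i).toMeasure) l (𝓝 (∫ y, f y ∂μ.toMeasure)) := by
  rw [ProbabilityMeasure.tendsto_iff_forall_integral_tendsto]
  exact ⟨fun h f => h (BoundedContinuousFunction.mkOfCompact f), fun h f => h f.toContinuousMap⟩

lemma h_gen_unique {T : X ≃ₜ X} {x : X} {μ ν : ProbabilityMeasure X}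
    (h : IsGenericFor T x μ) (h' : IsGenericFor T x ν) : μ = ν :=
  h_ext _ _ fun f => tendsto_nhds_unique (h f) (h' f)

lemma h_cesaro_bound (T : X ≃ₜ X) (f : C(X, ℝ)) (n : ℕ) (x : X) :
    ‖cesaro T f n x‖ ≤ ‖f‖ := by
  unfold cesaro
  rcases Nat.eq_zero_or_pos n with rfl | hn
  · simp
  have h1 : ‖∑ i ∈ Finset.range n, f (T^[i] x)‖ ≤ n * ‖f‖ := by
    refine (norm_sum_le_of_le _ fun i _ => f.norm_coe_le_norm _).trans ?_
    simp
  rw [norm_mul, norm_inv, Real.norm_natCast]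
  have : (0:ℝ) < n := by exact_mod_cast hn
  rw [inv_mul_le_iff₀ this]
  exact h1

lemma h_cesaro_cont (T : X ≃ₜ X) (f : C(X, ℝ)) (n : ℕ) :
    Continuous (cesaro T f n) := by
  unfold cesaro
  refine continuous_const.mul (continuous_finsetSum _ fun i _ => f.continuous.comp ?_)
  exact T.continuous.iterate i

lemma h_cesaro_shift (T : X ≃ₜ X) (f : C(X, ℝ)) (x : X) :
    Tendsto (fun n => cesaro T f n (T x) - cesaro T f n x) atTop (𝓝 0) := by
  have h1 : ∀ n, cesaro T f n (T x) - cesaro T f n x = (n:ℝ)⁻¹ * (f (T^[n] x) - f x) := by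
    intro n
    unfold cesaro
    rw [← mul_sub, ← Finset.sum_sub_distrib]
    congr 1
    have := Finset.sum_range_sub (fun i => f (T^[i] x)) n
    simpa [Function.iterate_succ_apply] using this
  simp_rw [h1]
  refine squeeze_zero_norm (a := fun n : ℕ => (n:ℝ)⁻¹ * (2 * ‖f‖)) (fun n => ?_) ?_
  · rw [norm_mul, norm_inv, Real.norm_natCast]
    gcongr
    refine (norm_sub_le _ _).trans ?_
    have := f.norm_coe_le_norm (T^[n] x)
    have := f.norm_coe_le_norm x
    linarith
  · simpa using (tendsto_inv_atTop_nhds_zero_nat (𝕜 := ℝ)).mul_const (2 * ‖f‖)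

lemma h_gen_shift {T : X ≃ₜ X} {x : X} {μ : ProbabilityMeasure X}
    (h : IsGenericFor T x μ) : IsGenericFor T (T x) μ := by
  intro f
  have := (h f).add (h_cesaro_shift T f x)
  simpa using this

lemma h_int_cesaro {T : X ≃ₜ X} {μ : Measure X} [IsFiniteMeasure μ] (h : μ.map T = μ)
    (f : C(X, ℝ)) {n : ℕ} (hn : 0 < n) : ∫ x, cesaro T f n x ∂μ = ∫ x, f x ∂μ := by
  unfold cesaro
  have hT : MeasurePreserving T μ μ := ⟨T.continuous.measurable, h⟩
  rw [integral_const_mul, integral_finsetSum]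
  · have : ∀ i, ∫ x, f (T^[i] x) ∂μ = ∫ x, f x ∂μ := by
      intro i
      have h2 := hT.iterate i
      conv_rhs => rw [← h2.map_eq]
      rw [integral_map h2.measurable.aemeasurable f.continuous.aestronglyMeasurable]
    simp only [this, Finset.sum_const, Finset.card_range, nsmul_eq_mul]
    have : (n:ℝ) ≠ 0 := by exact_mod_cast hn.ne'
    field_simp
  · intro i _
    exact h_integrable μ (f.comp ⟨_, T.continuous.iterate i⟩)

/-- Averaging against an invariant measure. -/
lemma h_avg {T : X ≃ₜ X} {μ : Measure X} [IsFiniteMeasure μ] (h : μ.map T = μ)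
    (f : C(X, ℝ)) (g : X → ℝ)
    (hg : ∀ᵐ x ∂μ, Tendsto (fun n => cesaro T f n x) atTop (𝓝 (g x))) :
    ∫ x, g x ∂μ = ∫ x, f x ∂μ := by
  have h1 := tendsto_integral_of_dominated_convergence (μ := μ)
    (F := fun n x => cesaro T f n x) (f := g)
    (fun _ => ‖f‖) (fun n => (h_cesaro_cont T f n).aestronglyMeasurable) (integrable_const _)
    (fun n => ae_of_all _ fun x => h_cesaro_bound T f n x) hg
  refine tendsto_nhds_unique h1 (tendsto_const_nhds.congr' ?_)
  filter_upwards [eventually_gt_atTop 0] with n hn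
  exact (h_int_cesaro h f hn).symm

lemma h_full (μ : ProbabilityMeasure X) {K : Set X} (hK : IsClosed K) (hne : K.Nonempty)
    (h : ∀ f : C(X, ℝ), (∀ y ∈ K, f y = 0) → ∫ y, f y ∂μ.toMeasure = 0) :
    μ.toMeasure K = 1 := by
  let f : C(X, ℝ) := ⟨fun y => infDist y K, continuous_infDist_pt K⟩
  have h1 := h f fun y hy => infDist_zero_of_mem hy
  have hnn : 0 ≤ (f : X → ℝ) := fun y => infDist_nonneg
  rw [integral_eq_zero_iff_of_nonneg hnn (h_integrable _ f)] at h1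
  rw [← prob_compl_eq_zero_iff hK.measurableSet]
  refine measure_mono_null ?_ (ae_iff.1 h1)
  intro y hy hy0
  exact hy ((hK.mem_iff_infDist_zero hne).2 hy0)

lemma h_iter_mem {T : X ≃ₜ X} {K : Set X} (hK : IsInvariantSet T K) {x : X} (hx : x ∈ K) (i : ℕ) :
    T^[i] x ∈ K := by
  induction i with
  | zero => exact hx
  | succ n ih =>
    rw [Function.iterate_succ_apply']
    have := Set.mem_image_of_mem T ih
    rwa [hK] at this

lemma h_cesaro_zero {T : X ≃ₜ X} {K : Set X} (hK : IsInvariantSet T K) {x : X} (hx : x ∈ K)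
    (f : C(X, ℝ)) (hf : ∀ y ∈ K, f y = 0) (n : ℕ) : cesaro T f n x = 0 := by
  unfold cesaro
  rw [Finset.sum_eq_zero fun i _ => hf _ (h_iter_mem hK hx i), mul_zero]

lemma h_gen_full {T : X ≃ₜ X} {K : Set X} (hc : IsClosed K) (hK : IsInvariantSet T K) {x : X}
    (hx : x ∈ K) {μ : ProbabilityMeasure X} (h : IsGenericFor T x μ) : μ.toMeasure K = 1 := by
  refine h_full μ hc ⟨x, hx⟩ fun f hf => ?_
  refine tendsto_nhds_unique (h f) ?_
  simp [h_cesaro_zero hK hx f hf]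

lemma h_inv_of_erg {T : X ≃ₜ X} {μ : ProbabilityMeasure X} (h : IsErgodicMeasure T μ) :
    IsInvariantMeasure T μ := h.toMeasurePreserving.map_eq

lemma h_msupp_closed (μ : ProbabilityMeasure X) : IsClosed (msupp μ) := by
  rw [← isOpen_compl_iff, isOpen_iff_mem_nhds]
  intro x hx
  simp only [msupp, Set.mem_compl_iff, Set.mem_ofPred_eq, not_forall] at hx
  obtain ⟨U, hU, hxU, h0⟩ := hx
  filter_upwards [hU.mem_nhds hxU] with y hy h
  exact h0 (h U hU hy)

lemma h_msupp_full (μ : ProbabilityMeasure X) : μ.toMeasure (msupp μ) = 1 := by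
  rw [← prob_compl_eq_zero_iff (h_msupp_closed μ).measurableSet]
  refine measure_null_of_locally_null _ fun x hx => ?_
  simp only [msupp, Set.mem_compl_iff, Set.mem_ofPred_eq, not_forall] at hx
  obtain ⟨U, hU, hxU, h0⟩ := hx
  exact ⟨U, mem_nhdsWithin_of_mem_nhds (hU.mem_nhds hxU), by simpa using h0⟩

lemma h_msupp_nonempty (μ : ProbabilityMeasure X) : (msupp μ).Nonempty := by
  rw [Set.nonempty_iff_ne_empty]
  intro h
  have := h_msupp_full μ
  simp [h] at this

lemma h_msupp_sub (μ : ProbabilityMeasure X) {K : Set X} (hK : IsClosed K)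
    (h : μ.toMeasure K = 1) : msupp μ ⊆ K := by
  intro x hx
  by_contra hxK
  have := hx Kᶜ hK.isOpen_compl hxK
  rw [(prob_compl_eq_zero_iff hK.measurableSet).2 h] at this
  exact lt_irrefl _ this

lemma h_msupp_inv {T : X ≃ₜ X} {μ : ProbabilityMeasure X} (h : IsInvariantMeasure T μ) :
    IsInvariantSet T (msupp μ) := by
  have hT : MeasurePreserving T μ.toMeasure μ.toMeasure := ⟨T.continuous.measurable, h⟩
  have key : ∀ x, T x ∈ msupp μ ↔ x ∈ msupp μ := by
    intro x
    constructor
    · intro hx U hU hxU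
      have h1 := hx (T.symm ⁻¹' U) (hU.preimage T.symm.continuous) (by simpa using hxU)
      rw [← hT.measure_preimage (hU.preimage T.symm.continuous).measurableSet.nullMeasurableSet,
        ← Set.preimage_comp] at h1
      simpa using h1
    · intro hx U hU hxU
      have h1 := hx (T ⁻¹' U) (hU.preimage T.continuous) hxU
      rwa [hT.measure_preimage hU.measurableSet.nullMeasurableSet] at h1
  ext y
  constructor
  · rintro ⟨x, hx, rfl⟩
    exact (key x).2 hx
  · intro hy
    refine ⟨T.symm y, (key _).1 (by simpa using hy), by simp⟩

lemma h_msupp_min {T : X ≃ₜ X} {μ : ProbabilityMeasure X} (h : IsInvariantMeasure T μ)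
    {K : Set X} (hK : IsMinimalSet T K) (h1 : μ.toMeasure K = 1) : msupp μ = K :=
  hK.2.2.2 _ (h_msupp_sub μ hK.2.1 h1) (h_msupp_nonempty μ) (h_msupp_closed μ) (h_msupp_inv h)

lemma h_int_cont (μ : ProbabilityMeasure X) :
    Continuous fun f : C(X, ℝ) => ∫ y, f y ∂μ.toMeasure := by
  refine (LipschitzWith.of_dist_le_mul (K := 1) fun f g => ?_).continuous
  rw [NNReal.coe_one, one_mul, dist_eq_norm,
    ← integral_sub (h_integrable _ f) (h_integrable _ g)]
  have := norm_integral_le_of_norm_le_const (μ := μ.toMeasure) (C := dist f g)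
    (f := fun y => f y - g y) (ae_of_all _ fun y => by
      rw [← dist_eq_norm]; exact ContinuousMap.dist_apply_le_dist y)
  simpa using this

lemma h_erg_eq {T : X ≃ₜ X} (Φ : X → ProbabilityMeasure X) (hΦ : ∀ x, IsGenericFor T x (Φ x))
    {μ : ProbabilityMeasure X} (hμ : IsErgodicMeasure T μ) : ∃ y, Φ y = μ := by
  have hinv : ∀ x, Φ (T x) = Φ x := fun x => h_gen_unique (hΦ (T x)) (h_gen_shift (hΦ x))
  have h1 : ∀ f : C(X, ℝ), ∀ᵐ y ∂μ.toMeasure,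
      ∫ z, f z ∂(Φ y).toMeasure = ∫ z, f z ∂μ.toMeasure := by
    intro f
    have hm : Measurable fun y => ∫ z, f z ∂(Φ y).toMeasure :=
      measurable_of_tendsto_metrizable (f := fun n x => cesaro T f n x)
        (fun n => (h_cesaro_cont T f n).measurable) (tendsto_pi_nhds.2 fun x => hΦ x f)
    obtain ⟨c, hc⟩ := PreErgodic.ae_eq_const_of_ae_eq_comp (Ergodic.toPreErgodic hμ) hm
      (by ext x; simp [hinv])
    have h2 := h_avg (h_inv_of_erg hμ) f (fun y => ∫ z, f z ∂(Φ y).toMeasure)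
      (ae_of_all _ fun x => hΦ x f)
    rw [integral_congr_ae hc] at h2
    simp only [Function.const_apply, integral_const, probReal_univ, one_smul] at h2
    filter_upwards [hc] with y hy
    rw [hy, ← h2, Function.const_apply]
  have h2 := ae_all_iff.2 fun n => h1 (TopologicalSpace.denseSeq C(X, ℝ) n)
  obtain ⟨y, hy⟩ := h2.exists
  refine ⟨y, h_ext _ _ fun f => ?_⟩
  have := (TopologicalSpace.denseRange_denseSeq C(X, ℝ)).equalizer (h_int_cont (Φ y))
    (h_int_cont μ) (funext hy)
  exact congrFun this f

lemma h_ue_ergodic {T : X ≃ₜ X} {K : Set X} (hK : IsClosed K) {ν : ProbabilityMeasure X}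
    (hν : IsInvariantMeasure T ν) (hνK : ν.toMeasure K = 1)
    (hu : ∀ ρ : ProbabilityMeasure X, IsInvariantMeasure T ρ → ρ.toMeasure K = 1 → ρ = ν) :
    IsErgodicMeasure T ν := by
  have h0 := (prob_compl_eq_zero_iff hK.measurableSet).2 hνK
  refine Ergodic.of_mem_extremePoints ?_
  refine mem_extremePoints_iff_left.2 ⟨⟨⟨T.continuous.measurable, hν⟩, inferInstance⟩, ?_⟩
  rintro μ₁ ⟨h1, h1p⟩ μ₂ ⟨h2, h2p⟩ ⟨a, b, ha, hb, hab, hs⟩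
  have h3 : μ₁ Kᶜ = 0 := by
    have : (a • μ₁ + b • μ₂) Kᶜ = 0 := by rw [hs]; exact h0
    simp only [Measure.coe_add, Measure.coe_smul, Pi.add_apply, Pi.smul_apply, smul_eq_mul,
      add_eq_zero, mul_eq_zero, ha.ne', false_or] at this
    exact this.1
  have h4 : μ₁ K = 1 := (prob_compl_eq_zero_iff hK.measurableSet).1 h3
  have := hu ⟨μ₁, h1p⟩ h1.map_eq h4
  exact congrArg ProbabilityMeasure.toMeasure this

noncomputable def h_emp (T : X ≃ₜ X) (x : X) (n : ℕ) : ProbabilityMeasure X :=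
  ⟨((n + 1 : ℕ) : ENNReal)⁻¹ • ∑ i ∈ Finset.range (n + 1), Measure.dirac (T^[i] x), ⟨by
    simp only [Measure.coe_smul, Pi.smul_apply, Measure.coe_finsetSum, Finset.sum_apply,
      measure_univ, Finset.sum_const, Finset.card_range, nsmul_eq_mul, mul_one, smul_eq_mul]
    exact ENNReal.inv_mul_cancel (by simp) (ENNReal.natCast_ne_top _)⟩⟩

lemma h_emp_int (T : X ≃ₜ X) (x : X) (n : ℕ) (f : C(X, ℝ)) :
    ∫ y, f y ∂(h_emp T x n).toMeasure = cesaro T f (n + 1) x := by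
  change ∫ y, f y ∂(((n + 1 : ℕ) : ENNReal)⁻¹ •
    ∑ i ∈ Finset.range (n + 1), Measure.dirac (T^[i] x)) = _
  rw [integral_smul_measure, integral_finsetSum_measure (fun i _ => h_integrable _ f),
    ENNReal.toReal_inv, ENNReal.toReal_natCast]
  simp only [cesaro, integral_dirac, smul_eq_mul]

lemma h_ue_generic {T : X ≃ₜ X} {K : Set X} (hK : IsClosed K) (hKi : IsInvariantSet T K)
    {x : X} (hx : x ∈ K) {ν : ProbabilityMeasure X}
    (hu : ∀ ρ : ProbabilityMeasure X, IsInvariantMeasure T ρ → ρ.toMeasure K = 1 → ρ = ν) :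
    IsGenericFor T x ν := by
  have h1 : Tendsto (h_emp T x) atTop (𝓝 ν) := by
    refine tendsto_nhds_of_unique_mapClusterPt fun ρ hρ => ?_
    obtain ⟨U, hU, hUρ⟩ := mapClusterPt_iff_ultrafilter.1 hρ
    have h2 := h_tendsto.1 hUρ
    simp only [h_emp_int] at h2
    refine hu ρ ?_ ?_
    · have : IsProbabilityMeasure (ρ.toMeasure.map T) :=
        Measure.isProbabilityMeasure_map T.continuous.measurable.aemeasurable
      refine h_mext _ _ fun f => ?_
      rw [integral_map T.continuous.measurable.aemeasurable f.continuous.aestronglyMeasurable]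
      have h3 := h2 (f.comp ⟨T, T.continuous⟩)
      refine tendsto_nhds_unique h3 ?_
      have h4 := (((tendsto_add_atTop_iff_nat 1).2 (h_cesaro_shift T f x)).mono_left hU).add (h2 f)
      simp only [sub_add_cancel, zero_add] at h4
      refine h4.congr fun n => ?_
      simp only [cesaro, ContinuousMap.comp_apply, ContinuousMap.coe_mk]
      congr 1
      refine Finset.sum_congr rfl fun i _ => ?_
      rw [← Function.iterate_succ_apply, Function.iterate_succ_apply']
    · refine h_full ρ hK ⟨x, hx⟩ fun f hf => tendsto_nhds_unique (h2 f) ?_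
      simp [h_cesaro_zero hKi hx f hf]
  intro f
  have h5 := h_tendsto.1 h1 f
  simp only [h_emp_int] at h5
  exact (tendsto_add_atTop_iff_nat 1).1 h5

lemma h_min_eq {T : X ≃ₜ X} {K L : Set X} (hK : IsMinimalSet T K) (hL : IsMinimalSet T L)
    {x : X} (hxK : x ∈ K) (hxL : x ∈ L) : K = L := by
  have hi : IsInvariantSet T (K ∩ L) := by
    unfold IsInvariantSet
    rw [Set.image_inter T.injective, hK.2.2.1, hL.2.2.1]
  rw [← hK.2.2.2 (K ∩ L) Set.inter_subset_left ⟨x, hxK, hxL⟩ (hK.2.1.inter hL.2.1) hi]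
  exact hL.2.2.2 (K ∩ L) Set.inter_subset_right ⟨x, hxK, hxL⟩ (hK.2.1.inter hL.2.1) hi

lemma h_haus_ne_top {s t : Set X} (hs : s.Nonempty) (ht : t.Nonempty) :
    hausdorffEDist s t ≠ ⊤ :=
  hausdorffEDist_ne_top_of_nonempty_of_bounded hs ht
    (isCompact_univ.isBounded.subset (Set.subset_univ _))
    (isCompact_univ.isBounded.subset (Set.subset_univ _))

lemma h_backward {T : X ≃ₜ X} (hS : StrictlyPartitionable T) (hC : IsCompact (ErgodicSet T))
    (hsupp : SuppContinuousOnErgodic T) : ContinuouslyStrictlyPointwiseErgodic T := by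
  choose K hxK hmin hue using hS
  choose Φ hΦ hu using hue
  simp only [and_imp] at hu
  have hinv := fun x => (hΦ x).1
  have hone := fun x => (hΦ x).2
  have herg : ∀ x, IsErgodicMeasure T (Φ x) := fun x =>
    h_ue_ergodic (hmin x).2.1 (hinv x) (hone x) (hu x)
  have hgen : ∀ x, IsGenericFor T x (Φ x) := fun x =>
    h_ue_generic (hmin x).2.1 (hmin x).2.2.1 (hxK x) (hu x)
  have hms : ∀ x, msupp (Φ x) = K x := fun x => h_msupp_min (hinv x) (hmin x) (hone x)
  refine ⟨⟨Φ, ?_, fun x => ⟨herg x, hgen x⟩⟩, fun x => ⟨K x, hmin x, hxK x⟩⟩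
  rw [continuous_iff_seqContinuous]
  intro u x hux
  refine tendsto_of_subseq_tendsto fun ns hns => ?_
  obtain ⟨μ, hμ, φ, hφ, hlim⟩ := hC.tendsto_subseq (x := fun n => Φ (u (ns n)))
    (fun n => herg _)
  refine ⟨φ, ?_⟩
  have hd := hsupp μ hμ _ (fun n => herg _) hlim
  have hux' : Tendsto (fun n => u (ns (φ n))) atTop (𝓝 x) :=
    hux.comp (hns.comp hφ.tendsto_atTop)
  obtain ⟨y, rfl⟩ := h_erg_eq Φ hgen hμ
  have hx : x ∈ msupp (Φ y) := by
    rw [(h_msupp_closed _).mem_iff_infDist_zero (h_msupp_nonempty _)]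
    have h1 : Tendsto (fun n => infDist (u (ns (φ n))) (msupp (Φ y))) atTop
        (𝓝 (infDist x (msupp (Φ y)))) :=
      ((continuous_infDist_pt _).tendsto x).comp hux'
    refine tendsto_nhds_unique h1 (squeeze_zero (fun n => infDist_nonneg) (fun n => ?_) hd)
    refine infDist_le_hausdorffDist_of_mem ?_
      (h_haus_ne_top (h_msupp_nonempty _) (h_msupp_nonempty _))
    simp only [Function.comp_apply, hms]
    exact hxK _
  rw [hms] at hx
  have hKK := h_min_eq (hmin x) (hmin y) (hxK x) hx
  have : Φ y = Φ x := hu x _ (hinv y) (by rw [hKK]; exact hone y)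
  rw [← this]
  exact hlim

section Forward

variable {T : X ≃ₜ X} {Φ : X → ProbabilityMeasure X}

lemma h_const (hc : Continuous Φ) (hgen : ∀ x, IsGenericFor T x (Φ x))
    {K : Set X} (hK : IsMinimalSet T K) {x y : X} (hx : x ∈ K) (hy : y ∈ K) : Φ y = Φ x := by
  have hinv : ∀ x, Φ (T x) = Φ x := fun x => h_gen_unique (hgen (T x)) (h_gen_shift (hgen x))
  have h1 : K ∩ Φ ⁻¹' {Φ x} = K := by
    refine hK.2.2.2 _ Set.inter_subset_left ⟨x, hx, rfl⟩
      (hK.2.1.inter (isClosed_singleton.preimage hc)) ?_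
    unfold IsInvariantSet
    rw [Set.image_inter T.injective, hK.2.2.1]
    congr 1
    ext z
    constructor
    · rintro ⟨w, hw, rfl⟩
      exact (hinv w).trans hw
    · intro hz
      refine ⟨T.symm z, ?_, by simp⟩
      have := hinv (T.symm z)
      rw [T.apply_symm_apply] at this
      exact this.symm.trans hz
  rw [← h1] at hy
  exact hy.2

lemma h_msupp_K (herg : ∀ x, IsErgodicMeasure T (Φ x)) (hgen : ∀ x, IsGenericFor T x (Φ x))
    {K : Set X} (hK : IsMinimalSet T K) {x : X} (hx : x ∈ K) : msupp (Φ x) = K :=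
  h_msupp_min (h_inv_of_erg (herg x)) hK (h_gen_full hK.2.1 hK.2.2.1 hx (hgen x))

lemma h_fiber (hc : Continuous Φ) (herg : ∀ x, IsErgodicMeasure T (Φ x))
    (hgen : ∀ x, IsGenericFor T x (Φ x)) (hS : SemiSimple T) (x y : X) :
    y ∈ msupp (Φ x) ↔ Φ y = Φ x := by
  obtain ⟨K, hK, hx⟩ := hS x
  constructor
  · intro hy
    rw [h_msupp_K herg hgen hK hx] at hy
    exact h_const hc hgen hK hx hy
  · intro h
    rw [← h]
    obtain ⟨L, hL, hy⟩ := hS y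
    rwa [h_msupp_K herg hgen hL hy]

lemma h_strict (hc : Continuous Φ) (herg : ∀ x, IsErgodicMeasure T (Φ x))
    (hgen : ∀ x, IsGenericFor T x (Φ x)) (hS : SemiSimple T) : StrictlyPartitionable T := by
  intro x
  obtain ⟨K, hK, hx⟩ := hS x
  refine ⟨K, hx, hK, Φ x, ⟨h_inv_of_erg (herg x), h_gen_full hK.2.1 hK.2.2.1 hx (hgen x)⟩, ?_⟩
  rintro μ ⟨hμ, hμK⟩
  refine h_ext _ _ fun f => ?_
  have h0 := (prob_compl_eq_zero_iff hK.2.1.measurableSet).2 hμK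
  have := h_avg (μ := μ.toMeasure) hμ f (fun _ => ∫ z, f z ∂(Φ x).toMeasure) (by
    have : ∀ᵐ y ∂μ.toMeasure, y ∈ K := h0
    filter_upwards [this] with y hy
    rw [← h_const hc hgen hK hx hy]
    exact hgen y f)
  rw [← this]
  simp

lemma h_ergset (herg : ∀ x, IsErgodicMeasure T (Φ x))
    (hgen : ∀ x, IsGenericFor T x (Φ x)) : ErgodicSet T = Set.range Φ := by
  ext μ
  constructor
  · intro h
    exact h_erg_eq Φ hgen h
  · rintro ⟨x, rfl⟩
    exact herg x

lemma h_suppcont (hc : Continuous Φ) (herg : ∀ x, IsErgodicMeasure T (Φ x))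
    (hgen : ∀ x, IsGenericFor T x (Φ x)) (hS : SemiSimple T) : SuppContinuousOnErgodic T := by
  have hfib : ∀ μ ∈ ErgodicSet T, ∀ y, y ∈ msupp μ ↔ Φ y = μ := by
    intro μ hμ y
    obtain ⟨x, rfl⟩ := h_erg_eq Φ hgen hμ
    exact h_fiber hc herg hgen hS x y
  intro μ hμ ν hν hlim
  rw [Metric.tendsto_nhds]
  intro ε' hε'
  obtain ⟨ε, hε, hlt⟩ := exists_between hε'
  have hup : ∀ᶠ n in atTop, ∀ y ∈ msupp (ν n), infDist y (msupp μ) ≤ ε := by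
    have hC : IsClosed {y | ε ≤ infDist y (msupp μ)} :=
      isClosed_le continuous_const (continuous_infDist_pt _)
    have hi : IsClosed (Φ '' {y | ε ≤ infDist y (msupp μ)}) := (hC.isCompact.image hc).isClosed
    have hnot : μ ∈ (Φ '' {y | ε ≤ infDist y (msupp μ)})ᶜ := by
      rintro ⟨y, hy, h⟩
      have h1 := infDist_zero_of_mem ((hfib μ hμ y).2 h)
      have h2 : ε ≤ infDist y (msupp μ) := hy
      linarith
    filter_upwards [hlim (hi.isOpen_compl.mem_nhds hnot)] with n hn y hy
    by_contra hcon
    exact hn ⟨y, (not_le.1 hcon).le, (hfib _ (hν n) y).1 hy⟩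
  have hlow : ∀ᶠ n in atTop, ∀ y ∈ msupp μ, infDist y (msupp (ν n)) ≤ ε := by
    obtain ⟨t, ht, hcov⟩ := (h_msupp_closed μ).isCompact.elim_nhds_subcover
      (fun y => ball y (ε / 2)) (fun y _ => ball_mem_nhds y (half_pos hε))
    have h1 : ∀ᶠ n in atTop, ∀ y ∈ t, ∃ z ∈ msupp (ν n), z ∈ ball y (ε / 2) := by
      rw [Finset.eventually_all]
      intro y hy
      have h2 := ht y hy (ball y (ε / 2)) isOpen_ball (mem_ball_self (half_pos hε))
      have h3 := h2.trans_le
        (ProbabilityMeasure.le_liminf_measure_open_of_tendsto hlim isOpen_ball)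
      filter_upwards [eventually_lt_of_lt_liminf h3] with n hn
      by_contra hcon
      push Not at hcon
      have h4 : ball y (ε / 2) ⊆ (msupp (ν n))ᶜ := fun z hz hz' => hcon z hz' hz
      have h5 := measure_mono_null h4
        ((prob_compl_eq_zero_iff (h_msupp_closed (ν n)).measurableSet).2 (h_msupp_full (ν n)))
      exact hn.ne' h5
    filter_upwards [h1] with n hn y hy
    obtain ⟨w, hw, hyw⟩ := Set.mem_iUnion₂.1 (hcov hy)
    obtain ⟨z, hz, hzw⟩ := hn w hw
    refine (infDist_le_dist_of_mem hz).trans ?_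
    rw [mem_ball] at hyw hzw
    have := dist_triangle_right y z w
    linarith
  filter_upwards [hup, hlow] with n h1 h2
  rw [Real.dist_eq, sub_zero, abs_of_nonneg hausdorffDist_nonneg]
  exact (hausdorffDist_le_of_infDist hε.le h1 h2).trans_lt hlt

lemma h_atom (hc : Continuous Φ) (herg : ∀ x, IsErgodicMeasure T (Φ x))
    (hgen : ∀ x, IsGenericFor T x (Φ x)) (hS : SemiSimple T)
    (A : ℕ → Set X) (hA : ∀ n, A n ∈ genericPartition T) (S : Set X) (hne : S.Nonempty)
    (hcS : IsCompact S) (hlim : Tendsto (fun n => hausdorffDist (A n) S) atTop (𝓝 0)) :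
    S ∈ genericPartition T := by
  have hfibeq : ∀ x, genericFiber T (Φ x) = msupp (Φ x) := by
    intro x
    ext y
    rw [h_fiber hc herg hgen hS x y]
    constructor
    · intro h
      exact h_gen_unique (hgen y) h
    · intro h
      change IsGenericFor T y (Φ x)
      rw [← h]
      exact hgen y
  have h1 : ∀ n, ∃ x, A n = msupp (Φ x) := by
    intro n
    obtain ⟨μ, hμ, -, h⟩ := hA n
    obtain ⟨x, rfl⟩ := h_erg_eq Φ hgen hμ
    exact ⟨x, h.trans (hfibeq x)⟩
  choose x hx using h1
  obtain ⟨s, hs⟩ := hne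
  have hfin : ∀ n, hausdorffEDist (A n) S ≠ ⊤ := fun n =>
    h_haus_ne_top (by rw [hx n]; exact h_msupp_nonempty _) ⟨s, hs⟩
  have h2 : ∀ n, ∃ a ∈ A n, dist a s < hausdorffDist (A n) S + 1 / ((n : ℝ) + 1) := by
    intro n
    obtain ⟨a, ha, h⟩ := exists_dist_lt_of_hausdorffDist_lt' hs
      (lt_add_of_pos_right (hausdorffDist (A n) S) (Nat.one_div_pos_of_nat (n := n))) (hfin n)
    exact ⟨a, ha, h⟩
  choose a haA had using h2
  have has : Tendsto a atTop (𝓝 s) := by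
    rw [tendsto_iff_dist_tendsto_zero]
    refine squeeze_zero (fun n => dist_nonneg) (fun n => (had n).le) ?_
    simpa using hlim.add (tendsto_one_div_add_atTop_nhds_zero_nat (𝕜 := ℝ))
  have hAa : ∀ n, A n = msupp (Φ (a n)) := by
    intro n
    have h := haA n
    rw [hx n, h_fiber hc herg hgen hS] at h
    rw [hx n, h]
  have hΦ : Tendsto (fun n => Φ (a n)) atTop (𝓝 (Φ s)) := (hc.tendsto s).comp has
  have h3 := h_suppcont hc herg hgen hS (Φ s) (herg s) _ (fun n => herg (a n)) hΦ
  have h4 : hausdorffDist (msupp (Φ s)) S = 0 := by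
    refine le_antisymm ?_ hausdorffDist_nonneg
    have h5 := h3.add hlim
    rw [add_zero] at h5
    refine ge_of_tendsto' h5 fun n => ?_
    rw [hAa n, hausdorffDist_comm (s := msupp (Φ (a n))) (t := msupp (Φ s))]
    exact hausdorffDist_triangle (h_haus_ne_top (h_msupp_nonempty _) (h_msupp_nonempty _))
  have h6 : msupp (Φ s) = S := ((h_msupp_closed _).hausdorffDist_zero_iff_eq hcS.isClosed
    (h_haus_ne_top (h_msupp_nonempty _) ⟨s, hs⟩)).1 h4
  exact ⟨Φ s, herg s, ⟨s, hgen s⟩, by rw [hfibeq, h6]⟩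

end Forward

end Helpers

/-- `(X,T)` is continuously strictly pointwise ergodic iff it is strictly
partitionable, `ℳ_T^e(X)` is compact, and `supp : ℳ_T^e(X) → 2^X` is continuous;
moreover in this case the generic-point partition `𝒫` is continuous (both upper and
lower semicontinuous). -/
theorem stmt_9 {X : Type*} [MetricSpace X] [CompactSpace X]
    [MeasurableSpace X] [BorelSpace X] (T : X ≃ₜ X) :
    (ContinuouslyStrictlyPointwiseErgodic T ↔
      StrictlyPartitionable T ∧ IsCompact (ErgodicSet T) ∧ SuppContinuousOnErgodic T) ∧
    (ContinuouslyStrictlyPointwiseErgodic T →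
      PartitionUSC (genericPartition T) ∧ PartitionLSC (genericPartition T)) := by
  refine ⟨⟨?_, fun h => h_backward h.1 h.2.1 h.2.2⟩, ?_⟩
  · rintro ⟨⟨Φ, hc, h⟩, hS⟩
    have herg := fun x => (h x).1
    have hgen := fun x => (h x).2
    refine ⟨h_strict hc herg hgen hS, ?_, h_suppcont hc herg hgen hS⟩
    rw [h_ergset herg hgen]
    exact isCompact_range hc
  · rintro ⟨⟨Φ, hc, h⟩, hS⟩
    have herg := fun x => (h x).1
    have hgen := fun x => (h x).2
    exact ⟨fun A hA S hne hcS hl =>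
        ⟨S, h_atom hc herg hgen hS A hA S hne hcS hl, subset_rfl⟩,
      fun A hA S hne hcS hl =>
        ⟨S, h_atom hc herg hgen hS A hA S hne hcS hl, subset_rfl⟩⟩
end

section
/- Every uniform topological dynamical system is continuously pointwise ergodic: if for every continuous f : X → ℝ the Cesàro means (1/n)∑_{i=0}^{n-1} f(T^i x) converge uniformly on X, then every point of X is generic for an ergodic measure and the map Φ assigning to each point the ergodic measure it generates is continuous. -/
open MeasureTheory Filter Topology Metric

section Helpers

variable {X : Type*} [MetricSpace X] [CompactSpace X]

lemma cesaro_eq_birk (T : X → X) (f : X → ℝ) (n : ℕ) (x : X) :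
    cesaro T f n x = birkhoffAverage ℝ T f n x := by
  simp [cesaro, birkhoffAverage, birkhoffSum]

lemma cesaro_continuous (T : X ≃ₜ X) (f : C(X, ℝ)) (n : ℕ) :
    Continuous (fun x => cesaro (⇑T) (⇑f) n x) := by
  unfold cesaro
  refine continuous_const.mul (continuous_finset_sum _ fun i _ => ?_)
  exact f.continuous.comp (T.continuous.iterate i)

lemma cesaro_bound (T : X ≃ₜ X) (f : C(X, ℝ)) (n : ℕ) (x : X) :
    ‖cesaro (⇑T) (⇑f) n x‖ ≤ ‖f‖ := by
  unfold cesaro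
  rcases Nat.eq_zero_or_pos n with rfl | hn
  · simp
  have hn' : (0 : ℝ) < n := by exact_mod_cast hn
  rw [norm_mul, norm_inv, Real.norm_natCast, inv_mul_le_iff₀ hn']
  calc _ ≤ ∑ i ∈ Finset.range n, ‖f (T^[i] x)‖ := norm_sum_le _ _
    _ ≤ ∑ i ∈ Finset.range n, ‖f‖ := Finset.sum_le_sum fun i _ => f.norm_coe_le_norm _
    _ = _ := by simp

lemma cesaro_shift (T : X ≃ₜ X) (f : C(X, ℝ)) (x : X) {a b : ℝ}
    (ha : Tendsto (fun n => cesaro (⇑T) (⇑f) n x) atTop (𝓝 a))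
    (hb : Tendsto (fun n => cesaro (⇑T) (⇑f) n (T x)) atTop (𝓝 b)) : b = a := by
  have h0 : Tendsto (fun n => birkhoffAverage ℝ (⇑T) (⇑f) n (T x) - birkhoffAverage ℝ (⇑T) (⇑f) n x)
      atTop (𝓝 0) := by
    apply tendsto_birkhoffAverage_apply_sub_birkhoffAverage'
    exact (isCompact_range f.continuous).isBounded
  have h1 := hb.sub ha
  simp only [cesaro_eq_birk] at h1
  have := tendsto_nhds_unique h1 h0
  linarith

lemma cesaro_comp (T : X ≃ₜ X) (f : X → ℝ) (n : ℕ) (x : X) :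
    cesaro (⇑T) (fun y => f (T y)) n x = cesaro (⇑T) f n (T x) := by
  unfold cesaro
  simp only [← Function.iterate_succ_apply', Function.iterate_succ_apply]

lemma cesaro_inv (T : X ≃ₜ X) (f : X → ℝ) (hf : ∀ y, f (T y) = f y) (x : X) :
    Tendsto (fun n => cesaro (⇑T) f n x) atTop (𝓝 (f x)) := by
  have hi : ∀ i : ℕ, f (T^[i] x) = f x := by
    intro i
    induction i with
    | zero => rfl
    | succ k ih => rw [Function.iterate_succ_apply', hf, ih]
  refine tendsto_const_nhds.congr' ?_
  filter_upwards [eventually_gt_atTop 0] with n hn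
  have hn' : (n : ℝ) ≠ 0 := by positivity
  simp [cesaro, hi, hn']

variable [MeasurableSpace X] [BorelSpace X]

lemma integral_limit (T : X ≃ₜ X) (ν : Measure X) [IsFiniteMeasure ν]
    (hν : MeasurePreserving (⇑T) ν ν) (f : C(X, ℝ)) (g : X → ℝ)
    (hg : ∀ x, Tendsto (fun n => cesaro (⇑T) (⇑f) n x) atTop (𝓝 (g x))) :
    ∫ x, g x ∂ν = ∫ x, f x ∂ν := by
  have h1 : Tendsto (fun n => ∫ x, cesaro (⇑T) (⇑f) n x ∂ν) atTop (𝓝 (∫ x, g x ∂ν)) := by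
    refine tendsto_integral_of_dominated_convergence (fun _ => ‖f‖)
      (fun n => (cesaro_continuous T f n).aestronglyMeasurable) (integrable_const _)
      (fun n => ae_of_all _ fun x => cesaro_bound T f n x) (ae_of_all _ hg)
  have hi : ∀ i : ℕ, ∫ x, f (T^[i] x) ∂ν = ∫ x, f x ∂ν := by
    intro i
    have := (hν.iterate i)
    conv_rhs => rw [← this.map_eq]
    rw [integral_map this.measurable.aemeasurable f.continuous.aestronglyMeasurable]
  refine tendsto_nhds_unique h1 (tendsto_const_nhds.congr' ?_)
  filter_upwards [eventually_gt_atTop 0] with n hn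
  have hn' : (n : ℝ) ≠ 0 := by positivity
  unfold cesaro
  rw [integral_const_mul, integral_finset_sum]
  · simp [hi, hn']
  · intro i _
    exact (f.continuous.comp (T.continuous.iterate i)).integrable_of_hasCompactSupport
      (HasCompactSupport.of_compactSpace _)

lemma measure_ext_C (μ ν : Measure X) [IsFiniteMeasure μ] [IsFiniteMeasure ν]
    (h : ∀ f : C(X, ℝ), ∫ x, f x ∂μ = ∫ x, f x ∂ν) : μ = ν :=
  ext_of_forall_integral_eq_of_IsFiniteMeasure fun f => h f.toContinuousMap

lemma exists_generic (T : X ≃ₜ X) (x : X) (G : C(X, ℝ) → ℝ)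
    (hG : ∀ f : C(X, ℝ), Tendsto (fun n => cesaro (⇑T) (⇑f) n x) atTop (𝓝 (G f))) :
    ∃ μ : ProbabilityMeasure X, ∀ f : C(X, ℝ), ∫ y, f y ∂μ.toMeasure = G f := by
  let Λ0 : CompactlySupportedContinuousMap X ℝ →ₗ[ℝ] ℝ :=
    { toFun := fun f => G f.toContinuousMap
      map_add' := by
        intro f g
        refine tendsto_nhds_unique (hG _) (((hG _).add (hG _)).congr fun n => ?_)
        simp [cesaro, Finset.sum_add_distrib, mul_add]
      map_smul' := by
        intro c f
        refine tendsto_nhds_unique (hG _) (((hG _).const_mul c).congr fun n => ?_)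
        simp [cesaro, ← Finset.mul_sum]
        ring }
  let Λ : CompactlySupportedContinuousMap X ℝ →ₚ[ℝ] ℝ := PositiveLinearMap.mk₀ Λ0 (by
    intro f hf
    refine ge_of_tendsto' (hG _) fun n => ?_
    unfold cesaro
    exact mul_nonneg (by positivity) (Finset.sum_nonneg fun i _ => hf _))
  have key : ∀ f : C(X, ℝ), ∫ y, f y ∂(RealRMK.rieszMeasure Λ) = G f := by
    intro f
    exact RealRMK.integral_rieszMeasure Λ (CompactlySupportedContinuousMap.continuousMapEquiv f)
  have h1 : ∫ y, (1 : C(X, ℝ)) y ∂(RealRMK.rieszMeasure Λ) = 1 := by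
    rw [key]
    exact tendsto_nhds_unique (hG _) (cesaro_inv T _ (fun _ => rfl) x)
  have hp : IsProbabilityMeasure (RealRMK.rieszMeasure Λ) := by
    constructor
    simp [Measure.real] at h1
    exact (ENNReal.toReal_eq_one_iff _).1 h1
  exact ⟨⟨_, hp⟩, key⟩

end Helpers

/-- every uniform system is continuously pointwise ergodic. -/
theorem stmt_10 {X : Type*} [MetricSpace X] [CompactSpace X]
    [MeasurableSpace X] [BorelSpace X] (T : X ≃ₜ X)
    (h : UniformSystem T) :
    ContinuouslyPointwiseErgodic T := by
  choose G hG using h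
  have hpt : ∀ f : C(X, ℝ), ∀ x, Tendsto (fun n => cesaro (⇑T) (⇑f) n x) atTop (𝓝 (G f x)) :=
    fun f x => (hG f).tendsto_at x
  have hcont : ∀ f, Continuous (G f) := fun f =>
    (hG f).continuous (Frequently.of_forall fun n => cesaro_continuous T f n)
  have hinv : ∀ f y, G f (T y) = G f y := fun f y =>
    cesaro_shift T f y (hpt f y) (hpt f (T y))
  choose Φ hΦ using fun x => exists_generic T x (fun f => G f x) (fun f => hpt f x)
  refine ⟨Φ, ?_, fun x => ⟨?_, ?_⟩⟩
  · rw [continuous_iff_continuousAt]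
    intro x
    refine ProbabilityMeasure.tendsto_iff_forall_integral_tendsto.2 fun f => ?_
    have e : ∀ y, ∫ z, f z ∂(Φ y).toMeasure = G f.toContinuousMap y :=
      fun y => hΦ y f.toContinuousMap
    simp only [e]
    exact (hcont _).tendsto x
  · have hmp : MeasurePreserving (⇑T) (Φ x).toMeasure (Φ x).toMeasure := by
      refine ⟨T.continuous.measurable, ?_⟩
      haveI : IsFiniteMeasure ((Φ x).toMeasure.map ⇑T) := inferInstance
      refine measure_ext_C _ _ fun f => ?_
      rw [integral_map T.continuous.measurable.aemeasurable f.continuous.aestronglyMeasurable]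
      have e := hΦ x (f.comp ⟨T, T.continuous⟩)
      simp only [ContinuousMap.comp_apply, ContinuousMap.coe_mk] at e
      rw [e, hΦ x f, ← hinv f x]
      refine tendsto_nhds_unique (hpt _ x) ((hpt f (T x)).congr fun n => ?_)
      exact (cesaro_comp T f n x).symm
    -- invariant continuous functions integrate to their value at x
    have hI : ∀ f : C(X, ℝ), (∀ y, f (T y) = f y) → ∫ y, f y ∂(Φ x).toMeasure = f x := by
      intro f hf
      rw [hΦ x f]
      exact tendsto_nhds_unique (hpt f x) (cesaro_inv T f hf x)
    have hae : ∀ f : C(X, ℝ), ∀ᵐ y ∂(Φ x).toMeasure, G f y = G f x := by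
      intro f
      let q : C(X, ℝ) := ⟨fun y => (G f y - G f x) ^ 2, by
        have := hcont f
        fun_prop⟩
      have hq : ∫ y, q y ∂(Φ x).toMeasure = 0 := by
        rw [hI q fun y => by simp [q, hinv]]
        simp [q]
      have hq0 : 0 ≤ ⇑q := fun y => sq_nonneg (G f y - G f x)
      rw [integral_eq_zero_iff_of_nonneg hq0
        (q.continuous.integrable_of_hasCompactSupport (HasCompactSupport.of_compactSpace _))] at hq
      filter_upwards [hq] with y hy
      have : (G f y - G f x) ^ 2 = 0 := hy
      exact sub_eq_zero.1 (pow_eq_zero_iff (two_ne_zero) |>.1 this)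
    refine ⟨hmp, ⟨fun A hA hTA => ?_⟩⟩
    have hmpA : MeasurePreserving (⇑T) ((Φ x).toMeasure.restrict A)
        ((Φ x).toMeasure.restrict A) := by
      have := hmp.restrict_preimage hA
      rwa [hTA] at this
    have hfin : (Φ x).toMeasure A ≠ ⊤ := measure_ne_top _ _
    haveI : IsFiniteMeasure ((Φ x).toMeasure A • (Φ x).toMeasure) :=
      Measure.smul_finite _ hfin
    have heq : (Φ x).toMeasure.restrict A = (Φ x).toMeasure A • (Φ x).toMeasure := by
      refine measure_ext_C _ _ fun f => ?_
      rw [← integral_limit T _ hmpA f (G f) (hpt f), integral_smul_measure, hΦ x f,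
        integral_congr_ae (ae_restrict_of_ae (hae f))]
      simp [Measure.real]
    have h0 : (Φ x).toMeasure A * (Φ x).toMeasure Aᶜ = 0 := by
      have := congrArg (fun m : Measure X => m Aᶜ) heq
      simpa [Measure.restrict_apply hA.compl] using this.symm
    rw [eventuallyConst_set']
    rcases mul_eq_zero.1 h0 with h | h
    · left
      exact ae_eq_empty.2 h
    · right
      exact ae_eq_univ.2 h
  · intro f
    rw [hΦ x f]
    exact hpt f x
end
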